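/- The product ∏_{i=1}^{2n-1} det L_i lies in I_Δ^{n(n-1)/2}, where I_Δ is the ideal of R generated by the differences y_{ij} − x_{ij} for 1 ≤ j < i ≤ n; that is, the polynomial δ(M(g,h)) restricted to U⁻ × U⁻ vanishes with multiplicity at least n(n-1)/2 on the diagonal. -/

import Mathlib

open MvPolynomial

/-- Index type for the variables `x_{rj}`, `y_{rj}` with `0 ≤ j < r < n` (0-indexed);
`false` tags an x-variable and `true` a y-variable. -/
def Vars (n : ℕ) : Type := {v : ℕ × ℕ // v.2 < v.1 ∧ v.1 < n} × Bool

instance (n : ℕ) : DecidableEq (Vars n) := by unfold Vars; infer_instance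

/-- The entry `x_{rj}` (`b = false`) or `y_{rj}` (`b = true`) (0-indexed), with the
conventions `x_{rr} = y_{rr} = 1` and `x_{rj} = y_{rj} = 0` for `r < j`. -/
noncomputable def ent (k : Type*) [Field k] (n r j : ℕ) (b : Bool) :
    MvPolynomial (Vars n) k :=
  if h : j < r ∧ r < n then X (⟨⟨(r, j), h.1, h.2⟩, b⟩ : Vars n)
  else if r = j then 1 else 0

/-- The entry of the `n × 2n` matrix `L` in row `r` and column `c` (0-indexed): the
columns alternate `x_{r0}, y_{r0}, x_{r1}, y_{r1}, …`. -/
noncomputable def Lent (k : Type*) [Field k] (n r c : ℕ) : MvPolynomial (Vars n) k :=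
  ent k n r (c / 2) (decide (c % 2 = 1))

/-- The size of the square matrix `L_i`, `1 ≤ i ≤ 2n-1`. -/
def sz (n i : ℕ) : ℕ := min i (2 * n - i)

/-- Row offset of `L_i` inside `L` (`n - i` for `i ≤ n` and `i - n` for `i ≥ n`). -/
def roff (n i : ℕ) : ℕ := (n - i) + (i - n)

/-- Column offset of `L_i` inside `L` (`0` for `i ≤ n` and `2(i-n)` for `i ≥ n`). -/
def coff (n i : ℕ) : ℕ := 2 * (i - n)

/-- The matrix `L_i`: for `1 ≤ i ≤ n` the `i × i` submatrix of `L` on the last `i`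
rows and the first `i` columns; for `n ≤ i ≤ 2n-1` the `(2n-i) × (2n-i)` submatrix
obtained from the first `i` columns of `L` by deleting the first `2(i-n)` columns
and the first `i - n` rows. -/
noncomputable def Lmat (k : Type*) [Field k] (n i : ℕ) :
    Matrix (Fin (sz n i)) (Fin (sz n i)) (MvPolynomial (Vars n) k) :=
  Matrix.of fun r c => Lent k n (roff n i + r.1) (coff n i + c.1)

/-- The determinant `det L_i`. -/
noncomputable def detL (k : Type*) [Field k] (n i : ℕ) : MvPolynomial (Vars n) k :=
  (Lmat k n i).det

/-- The ideal `I_Δ` of the diagonal of `U⁻ × U⁻`: the ideal generated by the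
differences `y_{rj} - x_{rj}` for `0 ≤ j < r < n`. -/
noncomputable def Idelta (k : Type*) [Field k] (n : ℕ) : Ideal (MvPolynomial (Vars n) k) :=
  Ideal.span (Set.range fun v : {v : ℕ × ℕ // v.2 < v.1 ∧ v.1 < n} =>
    (X (⟨v, true⟩ : Vars n) - X (⟨v, false⟩ : Vars n) : MvPolynomial (Vars n) k))

/-- Sum of the parities. -/
theorem aux_sum_parity (m : ℕ) : ∑ i : Fin m, (i.1 % 2) = m / 2 := by
  rw [Fin.sum_univ_eq_sum_range (fun i => i % 2)]
  induction m with
  | zero => simp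
  | succ k ih => rw [Finset.sum_range_succ, ih]; omega

/-- If odd-indexed columns lie in `I`, the determinant lies in `I ^ (m / 2)`. -/
theorem aux_det_mem {R : Type*} [CommRing R] (I : Ideal R) (m : ℕ)
    (N : Matrix (Fin m) (Fin m) R) (h : ∀ r c, c.1 % 2 = 1 → N r c ∈ I) :
    N.det ∈ I ^ (m / 2) := by
  rw [Matrix.det_apply]
  refine Ideal.sum_mem _ fun σ _ => ?_
  rw [Units.smul_def, zsmul_eq_mul]
  refine Ideal.mul_mem_left _ _ ?_
  rw [← aux_sum_parity m, ← Finset.prod_pow_eq_pow_sum]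
  refine Ideal.prod_mem_prod fun i _ => ?_
  rcases Nat.mod_two_eq_zero_or_one i.1 with h0 | h1
  · rw [h0]; simp
  · rw [h1, pow_one]; exact h _ _ h1

/-- If consecutive column pairs are congruent mod `I`, the determinant is in `I ^ (m / 2)`. -/
theorem aux_det_pairs {R : Type*} [CommRing R] (I : Ideal R) (m : ℕ) (f : ℕ → ℕ → R)
    (h : ∀ r c, c % 2 = 0 → f r (c + 1) - f r c ∈ I) :
    (Matrix.of fun (r c : Fin m) => f r.1 c.1).det ∈ I ^ (m / 2) := by
  cases m with
  | zero => simp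
  | succ m =>
    rw [Matrix.det_eq_of_forall_col_eq_smul_add_pred
      (B := Matrix.of fun (r c : Fin (m + 1)) =>
        if c.1 % 2 = 1 then f r.1 c.1 - f r.1 (c.1 - 1) else f r.1 c.1)
      (fun j : Fin m => if j.1 % 2 = 0 then 1 else 0)]
    · refine aux_det_mem I _ _ fun r c hc => ?_
      simp only [Matrix.of_apply, hc, if_true]
      have := h r.1 (c.1 - 1) (by omega)
      rwa [Nat.sub_add_cancel (by omega)] at this
    · intro i; simp
    · intro i j
      rcases Nat.mod_two_eq_zero_or_one j.1 with h0 | h1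
      · have : (j.1 + 1) % 2 = 1 := by omega
        simp [h0, this]
      · have : (j.1 + 1) % 2 = 0 := by omega
        simp [h1, this]

theorem aux_detL_mem {k : Type*} [Field k] (n i : ℕ) :
    detL k n i ∈ Idelta k n ^ (sz n i / 2) := by
  refine aux_det_pairs (Idelta k n) (sz n i)
    (fun r c => Lent k n (roff n i + r) (coff n i + c)) fun r c hc => ?_
  have e1 : (coff n i + (c + 1)) / 2 = (coff n i + c) / 2 := by unfold coff; omega
  have e2 : (coff n i + (c + 1)) % 2 = 1 := by unfold coff; omega
  have e3 : (coff n i + c) % 2 = 0 := by unfold coff; omega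
  simp only [Lent, e1, e2, e3, ent]
  split_ifs with h1 h2
  · exact Ideal.subset_span ⟨⟨(_, _), h1⟩, by simp; rfl⟩
  · simp
  · simp

theorem aux_sum_sz : ∀ n : ℕ, ∑ i ∈ Finset.range (2 * n), sz n i / 2 = n * (n - 1) / 2
  | 0 => by simp
  | 1 => by decide
  | n + 2 => by
    have ih := aux_sum_sz n
    have e : ∀ j ∈ Finset.range (2 * n), sz (n + 2) (j + 1 + 1) / 2 = sz n j / 2 + 1 := by
      intro j hj
      have := Finset.mem_range.1 hj
      unfold sz; omega
    have a1 : sz (n + 2) (2 * n + 1 + 1 + 1) / 2 = 0 := by unfold sz; omega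
    have a2 : sz (n + 2) (2 * n + 1 + 1) / 2 = 1 := by unfold sz; omega
    have a3 : sz (n + 2) (0 + 1) / 2 = 0 := by unfold sz; omega
    have a4 : sz (n + 2) 0 / 2 = 0 := by unfold sz; omega
    rw [show 2 * (n + 2) = 2 * n + 1 + 1 + 1 + 1 by ring, Finset.sum_range_succ',
      Finset.sum_range_succ', Finset.sum_range_succ, Finset.sum_range_succ, a1, a2, a3, a4,
      Finset.sum_congr rfl e, Finset.sum_add_distrib, ih]
    simp only [Finset.sum_const, Finset.card_range, smul_eq_mul]
    have : (n + 2) * (n + 2 - 1) = n * (n - 1) + 2 * (2 * n + 1) := by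
      cases n with
      | zero => rfl
      | succ k => simp only [Nat.add_sub_cancel, show k + 1 + 2 - 1 = k + 2 by omega]; ring
    rw [this]; omega

/-- The product `∏_{i=1}^{2n-1} det L_i` lies in `I_Δ^{n(n-1)/2}`: the restriction of
`δ(M(g,h))` to `U⁻ × U⁻` vanishes with multiplicity at least `n(n-1)/2` on the
diagonal. -/
theorem prod_detL_mem_Idelta_pow {k : Type*} [Field k] (n : ℕ) (hn : 2 ≤ n) :
    (∏ i ∈ Finset.Icc 1 (2 * n - 1), detL k n i) ∈
      Idelta k n ^ (n * (n - 1) / 2) := by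
  have hs : ∑ i ∈ Finset.Icc 1 (2 * n - 1), sz n i / 2 = n * (n - 1) / 2 := by
    rw [← aux_sum_sz n]
    refine Finset.sum_subset ?_ ?_
    · intro i hi
      rw [Finset.mem_Icc] at hi
      rw [Finset.mem_range]; omega
    · intro i hi hi'
      rw [Finset.mem_Icc] at hi'
      rw [Finset.mem_range] at hi
      unfold sz; omega
  rw [← hs, ← Finset.prod_pow_eq_pow_sum]
  exact Ideal.prod_mem_prod fun i _ => aux_detL_mem n i
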